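/- arXiv:2502.10902 — 3 statements merged into one kernel-verified Lean document; each statement's English description precedes it below -/
import Mathlib

section
/- For any infinite subset S of ℕ, the Hausdorff dimension of the set of irrationals x ∈ (0,1) whose regular continued fraction digits aₙ(x) all lie in S and tend to infinity is at most τ(S)/2, where τ(S) is the convergence exponent of S. -/
open Filter Set

/-- The Gauss map `x ↦ {1/x}`. -/
noncomputable def gaussMap (x : ℝ) : ℝ := Int.fract x⁻¹

/-- The `(n+1)`-st regular continued fraction digit of `x` (so `cfDigit 0 x = a₁(x)`). -/
noncomputable def cfDigit (n : ℕ) (x : ℝ) : ℕ := ⌊(gaussMap^[n] x)⁻¹⌋₊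

/-- The convergence exponent `τ(S) = inf {t ≥ 0 : ∑_{a ∈ S} a^{-t} < ∞}`. -/
noncomputable def convExponent (S : Set ℕ) : ℝ :=
  sInf {t : ℝ | 0 ≤ t ∧ Summable (fun a : S => (a : ℝ) ^ (-t))}

/-- Inverse branch of the Gauss map. -/
noncomputable def cfBranch (a : ℕ) (y : ℝ) : ℝ := ((a : ℝ) + y)⁻¹

/-- Irrationals in `(0,1)`. -/
def irrI : Set ℝ := {x | x ∈ Set.Ioo (0 : ℝ) 1 ∧ Irrational x}

theorem gauss_mem {x : ℝ} (hx : x ∈ irrI) : gaussMap x ∈ irrI := by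
  have hi : Irrational (gaussMap x) := by
    unfold gaussMap Int.fract
    exact (irrational_inv_iff.2 hx.2).sub_intCast _
  refine ⟨⟨lt_of_le_of_ne (Int.fract_nonneg _) ?_, Int.fract_lt_one _⟩, hi⟩
  intro h
  exact hi.ne_zero h.symm

theorem gauss_iter_mem {x : ℝ} (hx : x ∈ irrI) (n : ℕ) : gaussMap^[n] x ∈ irrI := by
  induction n with
  | zero => exact hx
  | succ n ih => rw [Function.iterate_succ_apply']; exact gauss_mem ih

theorem digit_pos {x : ℝ} (hx : x ∈ irrI) : 1 ≤ cfDigit 0 x := by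
  unfold cfDigit
  apply Nat.le_floor
  simpa using (one_le_inv₀ hx.1.1).2 hx.1.2.le

theorem branch_eq {x : ℝ} (hx : x ∈ irrI) : cfBranch (cfDigit 0 x) (gaussMap x) = x := by
  unfold cfBranch cfDigit gaussMap
  have h0 : 0 ≤ x⁻¹ := (inv_pos.2 hx.1.1).le
  simp only [Function.iterate_zero, id_eq]
  rw [natCast_floor_eq_intCast_floor h0, Int.floor_add_fract, inv_inv]

theorem digit_succ (n : ℕ) (x : ℝ) : cfDigit n (gaussMap x) = cfDigit (n + 1) x := by
  unfold cfDigit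
  rw [Function.iterate_succ_apply]

theorem branch_lip (a : ℕ) (ha : 1 ≤ a) :
    LipschitzOnWith (((a : NNReal) ^ 2)⁻¹) (cfBranch a) (Set.Ici 0) := by
  apply LipschitzOnWith.of_dist_le_mul
  intro x hx y hy
  have ha' : (1 : ℝ) ≤ a := by exact_mod_cast ha
  have hx' : (0 : ℝ) ≤ x := hx
  have hy' : (0 : ℝ) ≤ y := hy
  unfold cfBranch
  rw [Real.dist_eq, Real.dist_eq]
  have h1 : ((a : ℝ) + x)⁻¹ - ((a : ℝ) + y)⁻¹ = (y - x) * (((a : ℝ) + x) * ((a : ℝ) + y))⁻¹ := by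
    have : (a : ℝ) + x ≠ 0 := by positivity
    have : (a : ℝ) + y ≠ 0 := by positivity
    field_simp
    ring
  rw [h1, abs_mul, abs_sub_comm y x, mul_comm]
  apply mul_le_mul_of_nonneg_right _ (abs_nonneg _)
  rw [abs_of_nonneg (by positivity)]
  push_cast
  apply inv_anti₀ (by positivity)
  nlinarith [mul_nonneg hx' hy']

/-- Digits all in `S` and at least `M`. -/
def bigF (S : Set ℕ) (M : ℕ) : Set ℝ :=
  {x | x ∈ irrI ∧ ∀ n, M ≤ cfDigit n x ∧ cfDigit n x ∈ S}

theorem pull_dim (F : Set ℝ) (N : ℕ) :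
    dimH {x | x ∈ irrI ∧ gaussMap^[N] x ∈ F} ≤ dimH F := by
  induction N with
  | zero => exact dimH_mono (fun x hx => hx.2)
  | succ N ih =>
    have hsub : {x | x ∈ irrI ∧ gaussMap^[N + 1] x ∈ F} ⊆
        ⋃ k : ℕ, cfBranch (k + 1) '' {x | x ∈ irrI ∧ gaussMap^[N] x ∈ F} := by
      intro x hx
      have h1 := digit_pos hx.1
      refine mem_iUnion.2 ⟨cfDigit 0 x - 1, gaussMap x, ⟨gauss_mem hx.1, ?_⟩, ?_⟩
      · rw [← Function.iterate_succ_apply]; exact hx.2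
      · rw [Nat.sub_add_cancel h1]; exact branch_eq hx.1
    refine (dimH_mono hsub).trans ?_
    rw [dimH_iUnion]
    refine iSup_le fun k => le_trans ?_ ih
    exact ((branch_lip (k + 1) (by omega)).mono (fun x hx => hx.1.1.1.le)).dimH_image_le

theorem cover_exists (S : Set ℕ) (M : ℕ) (hM : 2 ≤ M) (d : ℝ) (hd : 0 < d) (c : ℕ → ENNReal)
    (hc : ∀ a ∈ S, 1 ≤ a → ((((a : NNReal) ^ 2)⁻¹ : NNReal) : ENNReal) ^ d ≤ c a)
    (hsum : ∑' k, c (k + M) ≤ 2⁻¹) (n : ℕ) :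
    ∃ (ι : Type) (_ : Countable ι) (t : ι → Set ℝ), bigF S M ⊆ ⋃ i, t i ∧
      (∀ i, t i ⊆ Ici 0) ∧
      (∀ i, Metric.ediam (t i) ≤ 2⁻¹ ^ n) ∧ ∑' i, Metric.ediam (t i) ^ d ≤ 2⁻¹ ^ n := by
  induction n with
  | zero =>
    have h1 : Metric.ediam (Ioo (0 : ℝ) 1) ≤ 1 := by
      rw [Real.ediam_Ioo]; simp
    refine ⟨Unit, inferInstance, fun _ => Ioo 0 1, ?_, ?_, ?_, ?_⟩
    · intro x hx
      exact mem_iUnion.2 ⟨(), hx.1.1⟩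
    · intro _ x hx
      exact hx.1.le
    · intro _; simpa using h1
    · simpa using ENNReal.rpow_le_one h1 hd.le
  | succ n ih =>
    classical
    obtain ⟨ι, hι, t, hcov, hpos, hdiam, hs⟩ := ih
    have hlip : ∀ a : ℕ, 1 ≤ a → ∀ i, Metric.ediam (cfBranch a '' t i) ≤
        ((((a : NNReal) ^ 2)⁻¹ : NNReal) : ENNReal) * Metric.ediam (t i) := fun a ha i =>
      by
        have h := (branch_lip a ha).mono (hpos i)
        refine Metric.ediam_le ?_
        rintro _ ⟨x, hx, rfl⟩ _ ⟨y, hy, rfl⟩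
        refine (h hx hy).trans ?_
        gcongr
        exact Metric.edist_le_ediam_of_mem hx hy
    refine ⟨ℕ × ι, inferInstance,
      fun p => if p.1 + M ∈ S then cfBranch (p.1 + M) '' t p.2 else ∅, ?_, ?_, ?_, ?_⟩
    · intro x hx
      have hg : gaussMap x ∈ bigF S M :=
        ⟨gauss_mem hx.1, fun n => by rw [digit_succ]; exact hx.2 _⟩
      obtain ⟨i, hi⟩ := mem_iUnion.1 (hcov hg)
      refine mem_iUnion.2 ⟨(cfDigit 0 x - M, i), ?_⟩
      have h0 := hx.2 0
      simp only [Nat.sub_add_cancel h0.1, if_pos h0.2]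
      exact ⟨_, hi, branch_eq hx.1⟩
    · rintro ⟨k, i⟩
      dsimp only
      split_ifs
      · rintro _ ⟨y, hy, rfl⟩
        have : (0 : ℝ) ≤ y := hpos i hy
        show (0 : ℝ) ≤ cfBranch _ y
        unfold cfBranch
        positivity
      · exact empty_subset _
    · rintro ⟨k, i⟩
      dsimp only
      split_ifs
      · refine (hlip (k + M) (by omega) i).trans ?_
        rw [pow_succ' (2⁻¹ : ENNReal) n]
        refine mul_le_mul' ?_ ?_
        · have : (((k + M : ℕ) : NNReal) ^ 2)⁻¹ ≤ 2⁻¹ := by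
            apply inv_anti₀ (by norm_num)
            have h2 : (2 : NNReal) ≤ ((k + M : ℕ) : NNReal) := by
              exact_mod_cast (by omega : 2 ≤ k + M)
            calc (2 : NNReal) ≤ 2 ^ 2 := by norm_num
              _ ≤ _ := by gcongr
          have h3 : ((2⁻¹ : NNReal) : ENNReal) = 2⁻¹ := by
            rw [ENNReal.coe_inv (by norm_num)]; rfl
          rw [← h3]
          exact_mod_cast this
        · exact hdiam i
      · simp
    · rw [ENNReal.summable.tsum_prod' (fun _ => ENNReal.summable)]
      calc _ ≤ ∑' (k : ℕ) (i : ι), c (k + M) * Metric.ediam (t i) ^ d := by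
            refine ENNReal.tsum_le_tsum fun k => ENNReal.tsum_le_tsum fun i => ?_
            dsimp only
            split_ifs with h
            · calc _ ≤ (((((k + M : ℕ) : NNReal) ^ 2)⁻¹ : NNReal) * Metric.ediam (t i)) ^ d :=
                    ENNReal.rpow_le_rpow (hlip _ (by omega) i) hd.le
                _ = _ := ENNReal.mul_rpow_of_nonneg _ _ hd.le
                _ ≤ _ := by
                    gcongr
                    exact hc _ h (by omega)
            · simp [ENNReal.zero_rpow_of_pos hd]
        _ = (∑' k, c (k + M)) * ∑' i, Metric.ediam (t i) ^ d := by
            simp_rw [ENNReal.tsum_mul_left, ENNReal.tsum_mul_right]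
        _ ≤ _ := by
            rw [pow_succ' (2⁻¹ : ENNReal) n]
            gcongr

theorem bigF_dim (S : Set ℕ) (M : ℕ) (hM : 2 ≤ M) (d : NNReal) (hd : 0 < d) (c : ℕ → ENNReal)
    (hc : ∀ a ∈ S, 1 ≤ a → ((((a : NNReal) ^ 2)⁻¹ : NNReal) : ENNReal) ^ (d : ℝ) ≤ c a)
    (hsum : ∑' k, c (k + M) ≤ 2⁻¹) : dimH (bigF S M) ≤ d := by
  choose ι hι t hcov _ hdiam hs using
    cover_exists S M hM d (by exact_mod_cast hd) c hc hsum
  have hlim : Tendsto (fun n : ℕ => (2⁻¹ : ENNReal) ^ n) atTop (nhds 0) :=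
    ENNReal.tendsto_pow_atTop_nhds_zero_of_lt_one (by norm_num)
  have h := MeasureTheory.Measure.hausdorffMeasure_le_liminf_tsum (d : ℝ) (bigF S M)
    (fun n : ℕ => (2⁻¹ : ENNReal) ^ n) hlim t (Eventually.of_forall hdiam)
    (Eventually.of_forall hcov)
  apply dimH_le_of_hausdorffMeasure_ne_top
  have h2 : liminf (fun n => ∑' i, Metric.ediam (t n i) ^ (d : ℝ)) atTop ≤ 0 := by
    rw [← hlim.liminf_eq]
    exact liminf_le_liminf (Eventually.of_forall hs)
  have h3 := h.trans h2
  intro h4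
  rw [h4] at h3
  simp at h3

theorem dim_le_of_summable (S : Set ℕ) (t : ℝ) (ht : 0 < t)
    (hs : Summable (fun a : S => (a : ℝ) ^ (-t))) :
    dimH {x : ℝ | x ∈ Set.Ioo (0 : ℝ) 1 ∧ Irrational x ∧
        (∀ n : ℕ, cfDigit n x ∈ S) ∧
        Filter.Tendsto (fun n : ℕ => cfDigit n x) Filter.atTop Filter.atTop} ≤
      ENNReal.ofReal (t / 2) := by
  classical
  let f : ℕ → ℝ := S.indicator (fun a => (a : ℝ) ^ (-t))
  have hf : Summable f := summable_subtype_iff_indicator.1 hs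
  let c : ℕ → ENNReal := fun a => ENNReal.ofReal (f a)
  have hcs : ∑' a, c a ≠ ⊤ := hf.tsum_ofReal_ne_top
  have hlim := ENNReal.tendsto_sum_nat_add c hcs
  obtain ⟨M, hM1, hM⟩ := ((hlim.eventually_le_const
    (by norm_num : (0 : ENNReal) < 2⁻¹)).and (eventually_ge_atTop 2)).exists
  have hc : ∀ a ∈ S, 1 ≤ a → ((((a : NNReal) ^ 2)⁻¹ : NNReal) : ENNReal) ^
      (((t / 2).toNNReal : NNReal) : ℝ) ≤ c a := by
    intro a ha h1
    have hpos : (0 : ℝ) < a := by exact_mod_cast h1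
    have hne : (((a : NNReal) ^ 2)⁻¹ : NNReal) ≠ 0 := by
      have : (a : NNReal) ≠ 0 := by exact_mod_cast (by omega : a ≠ 0)
      positivity
    rw [Real.coe_toNNReal _ (by positivity)]
    simp only [c, f, indicator_of_mem ha]
    rw [← ENNReal.ofReal_coe_nnreal, ENNReal.ofReal_rpow_of_nonneg (by positivity) (by positivity)]
    apply le_of_eq
    congr 1
    push_cast
    rw [Real.inv_rpow (by positivity), ← Real.rpow_natCast, ← Real.rpow_mul hpos.le,
      Real.rpow_neg hpos.le]
    congr 2
    push_cast
    ring
  have hF := bigF_dim S M hM (t / 2).toNNReal (by simpa using ht) c hc hM1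
  have hsub : {x : ℝ | x ∈ Set.Ioo (0 : ℝ) 1 ∧ Irrational x ∧
        (∀ n : ℕ, cfDigit n x ∈ S) ∧
        Filter.Tendsto (fun n : ℕ => cfDigit n x) Filter.atTop Filter.atTop} ⊆
      ⋃ N : ℕ, {x | x ∈ irrI ∧ gaussMap^[N] x ∈ bigF S M} := by
    rintro x ⟨hx, hi, hd, hl⟩
    obtain ⟨N, hN⟩ := eventually_atTop.1 (hl.eventually_ge_atTop M)
    have hx' : x ∈ irrI := ⟨hx, hi⟩
    refine mem_iUnion.2 ⟨N, hx', gauss_iter_mem hx' N, fun n => ?_⟩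
    have : cfDigit n (gaussMap^[N] x) = cfDigit (n + N) x := by
      unfold cfDigit
      rw [Function.iterate_add_apply]
    rw [this]
    exact ⟨hN _ (by omega), hd _⟩
  refine (dimH_mono hsub).trans ?_
  rw [dimH_iUnion]
  exact iSup_le fun N => (pull_dim _ N).trans hF

/-- For any infinite `S ⊆ ℕ`, the set of irrationals in `(0,1)` whose digits all lie in `S`
and tend to infinity has Hausdorff dimension at most `τ(S)/2`. -/
theorem stmt11 (S : Set ℕ) (hS : S.Infinite) :
    dimH {x : ℝ | x ∈ Set.Ioo (0 : ℝ) 1 ∧ Irrational x ∧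
        (∀ n : ℕ, cfDigit n x ∈ S) ∧
        Filter.Tendsto (fun n : ℕ => cfDigit n x) Filter.atTop Filter.atTop} ≤
      ENNReal.ofReal (convExponent S / 2) := by
  have hne : {t : ℝ | 0 ≤ t ∧ Summable (fun a : S => (a : ℝ) ^ (-t))}.Nonempty := by
    refine ⟨2, by norm_num, ?_⟩
    exact (Real.summable_nat_rpow.2 (by norm_num : (-2 : ℝ) < -1)).subtype S
  have hcont : Tendsto (fun t : ℝ => ENNReal.ofReal (t / 2))
      (nhdsWithin (convExponent S) (Ioi (convExponent S)))
      (nhds (ENNReal.ofReal (convExponent S / 2))) := by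
    apply Tendsto.mono_left _ nhdsWithin_le_nhds
    exact (ENNReal.continuous_ofReal.comp (continuous_id.div_const 2)).tendsto _
  refine ge_of_tendsto hcont ?_
  filter_upwards [self_mem_nhdsWithin] with u hu
  obtain ⟨t, ⟨ht0, hts⟩, htu⟩ := exists_lt_of_csInf_lt hne hu
  have ht : 0 < t := by
    rcases ht0.lt_or_eq with h | h
    · exact h
    · exfalso
      subst h
      have : Infinite S := hS.to_subtype
      simp at hts
      have h2 := hts.tendsto_cofinite_zero
      have h3 := tendsto_nhds_unique h2 tendsto_const_nhds
      norm_num at h3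
  refine (dim_le_of_summable S t ht hts).trans ?_
  apply ENNReal.ofReal_le_ofReal
  linarith
end

section
/- If S ⊆ ℕ has polynomial density with exponent α ≥ 1, then the Hausdorff dimension of {x ∈ (0,1)∖ℚ : the regular continued fraction digits of x are strictly increasing and all lie in S} equals 1/(2α); the same holds with 'strictly increasing' replaced by 'pairwise distinct'. -/
open Filter Set

/-- `S` has polynomial density with exponent `α`. -/
def HasPolyDensity (S : Set ℕ) (α : ℝ) : Prop :=
  ∃ C₁ C₂ β : ℝ, 0 < C₁ ∧ 0 < C₂ ∧ 0 ≤ β ∧ ∀ᶠ N : ℕ in Filter.atTop,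
    C₁ * (N : ℝ) ^ (1 / α) / (Real.log N) ^ β ≤ ((S ∩ Set.Icc 1 N).ncard : ℝ) ∧
      ((S ∩ Set.Icc 1 N).ncard : ℝ) ≤ C₂ * (N : ℝ) ^ (1 / α) / (Real.log N) ^ β


/-! ### Basic facts on the Gauss map -/

lemma gaussMap_mem {x : ℝ} (hi : Irrational x) :
    gaussMap x ∈ Ioo (0 : ℝ) 1 ∧ Irrational (gaussMap x) := by
  have h2 : Irrational (gaussMap x) := by
    unfold gaussMap Int.fract
    exact (irrational_inv_iff.2 hi).sub_intCast _
  refine ⟨⟨?_, Int.fract_lt_one _⟩, h2⟩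
  exact lt_of_le_of_ne (Int.fract_nonneg _) (fun h => h2.ne_zero h.symm)

lemma cfDigit_succ (n : ℕ) (x : ℝ) : cfDigit (n + 1) x = cfDigit n (gaussMap x) := by
  simp [cfDigit, Function.iterate_succ_apply]

lemma eq_inv_digit {x : ℝ} (hx : x ∈ Ioo (0 : ℝ) 1) :
    x = ((cfDigit 0 x : ℝ) + gaussMap x)⁻¹ := by
  have h0 : (0 : ℝ) ≤ x⁻¹ := (inv_pos.2 hx.1).le
  have : (cfDigit 0 x : ℝ) + gaussMap x = x⁻¹ := by
    simp only [cfDigit, gaussMap, Function.iterate_zero, id]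
    rw [natCast_floor_eq_intCast_floor h0]
    exact Int.floor_add_fract _
  rw [this, inv_inv]

lemma one_le_cfDigit_zero {x : ℝ} (hx : x ∈ Ioo (0 : ℝ) 1) : 1 ≤ cfDigit 0 x := by
  simp only [cfDigit, Function.iterate_zero, id]
  exact (Nat.one_le_floor_iff _).2 ((one_le_inv₀ hx.1).2 hx.2.le)

lemma branch_sub {a : ℕ} (ha : 1 ≤ a) {u v : ℝ} (hu : 0 ≤ u) (hv : 0 ≤ v) :
    |((a : ℝ) + u)⁻¹ - ((a : ℝ) + v)⁻¹| = |u - v| / (((a : ℝ) + u) * ((a : ℝ) + v)) := by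
  have ha' : (1 : ℝ) ≤ a := by exact_mod_cast ha
  have h1 : 0 < (a : ℝ) + u := by linarith
  have h2 : 0 < (a : ℝ) + v := by linarith
  rw [inv_sub_inv h1.ne' h2.ne', abs_div, abs_of_pos (mul_pos h1 h2), abs_sub_comm u v]
  congr 2
  ring

lemma branch_lip_s13 {a : ℕ} (ha : 1 ≤ a) {u v : ℝ} (hu : 0 ≤ u) (hv : 0 ≤ v) :
    |((a : ℝ) + u)⁻¹ - ((a : ℝ) + v)⁻¹| ≤ ((a : ℝ) ^ 2)⁻¹ * |u - v| := by
  have ha' : (1 : ℝ) ≤ a := by exact_mod_cast ha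
  rw [branch_sub ha hu hv, div_eq_inv_mul]
  gcongr
  nlinarith

lemma branch_lip_edist {a : ℕ} (ha : 1 ≤ a) {u v : ℝ} (hu : 0 ≤ u) (hv : 0 ≤ v) :
    edist (((a : ℝ) + u)⁻¹) (((a : ℝ) + v)⁻¹) ≤ ENNReal.ofReal (((a : ℝ) ^ 2)⁻¹) * edist u v := by
  rw [edist_dist, edist_dist, ← ENNReal.ofReal_mul (by positivity)]
  apply ENNReal.ofReal_le_ofReal
  simpa [Real.dist_eq] using branch_lip_s13 ha hu hv

/-! ### Upper bound -/

/-- Irrational points of `(0,1)` with all digits in `T`. -/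
def digitSet (T : Set ℕ) : Set ℝ :=
  {x : ℝ | x ∈ Ioo (0 : ℝ) 1 ∧ Irrational x ∧ ∀ n, cfDigit n x ∈ T}

lemma digitSet_cover (T : Set ℕ) (hT : ∀ a ∈ T, 2 ≤ a) (s : ℝ) (hs : 0 < s) (c : ENNReal)
    (hc : ∑' a : ℕ, T.indicator (fun a : ℕ => ENNReal.ofReal (((a : ℝ) ^ 2)⁻¹) ^ s) a ≤ c)
    (n : ℕ) :
    ∃ t : ℕ → Set ℝ, digitSet T ⊆ ⋃ i, t i ∧ (∀ i, t i ⊆ Icc 0 1) ∧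
      (∀ i, Metric.ediam (t i) ≤ (2⁻¹ : ENNReal) ^ n) ∧
      ∑' i, Metric.ediam (t i) ^ s ≤ c ^ n := by
  induction n with
  | zero =>
    refine ⟨fun i => if i = 0 then Icc 0 1 else ∅, ?_, ?_, ?_, ?_⟩
    · intro x hx
      refine mem_iUnion.2 ⟨0, ?_⟩
      simpa using ⟨hx.1.1.le, hx.1.2.le⟩
    · intro i
      dsimp only
      split_ifs <;> simp
    · intro i
      dsimp only
      split_ifs <;> simp
    · rw [tsum_eq_single 0]
      · simp
      · intro b hb
        simp [hb, hs]
  | succ n ih =>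
    obtain ⟨t, h1, h2, h3, h4⟩ := ih
    classical
    let t' : ℕ × ℕ → Set ℝ := fun p =>
      if p.1 ∈ T then (fun u : ℝ => ((p.1 : ℝ) + u)⁻¹) '' t p.2 else ∅
    have hd : ∀ a ∈ T, ∀ i, Metric.ediam ((fun u : ℝ => ((a : ℝ) + u)⁻¹) '' t i) ≤
        ENNReal.ofReal (((a : ℝ) ^ 2)⁻¹) * Metric.ediam (t i) := by
      intro a ha i
      rw [Metric.ediam_image_le_iff]
      intro u hu v hv
      refine (branch_lip_edist (by linarith [hT a ha]) (h2 i hu).1 (h2 i hv).1).trans ?_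
      gcongr
      exact Metric.edist_le_ediam_of_mem hu hv
    have hsum : ∑' p, Metric.ediam (t' p) ^ s ≤ c ^ (n + 1) := by
      have : ∀ p : ℕ × ℕ, Metric.ediam (t' p) ^ s ≤
          T.indicator (fun a : ℕ => ENNReal.ofReal (((a : ℝ) ^ 2)⁻¹) ^ s) p.1 *
            Metric.ediam (t p.2) ^ s := by
        intro p
        by_cases hp : p.1 ∈ T
        · simp only [t', if_pos hp, indicator_of_mem hp]
          rw [← ENNReal.mul_rpow_of_nonneg _ _ hs.le]
          exact ENNReal.rpow_le_rpow (hd _ hp _) hs.le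
        · simp [t', hp, hs]
      calc ∑' p, Metric.ediam (t' p) ^ s ≤ ∑' p : ℕ × ℕ,
          T.indicator (fun a : ℕ => ENNReal.ofReal (((a : ℝ) ^ 2)⁻¹) ^ s) p.1 *
            Metric.ediam (t p.2) ^ s := ENNReal.tsum_le_tsum this
        _ = (∑' a : ℕ, T.indicator (fun a : ℕ => ENNReal.ofReal (((a : ℝ) ^ 2)⁻¹) ^ s) a) *
            ∑' i, Metric.ediam (t i) ^ s := by
          rw [ENNReal.tsum_prod (f := fun a i =>
            T.indicator (fun a : ℕ => ENNReal.ofReal (((a : ℝ) ^ 2)⁻¹) ^ s) a *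
            Metric.ediam (t i) ^ s)]
          simp_rw [ENNReal.tsum_mul_left, ENNReal.tsum_mul_right]
        _ ≤ c * c ^ n := by gcongr
        _ = c ^ (n + 1) := by ring
    refine ⟨fun k => t' (Nat.unpair k), ?_, ?_, ?_, ?_⟩
    · intro x hx
      obtain ⟨hx1, hx2, hx3⟩ := hx
      have hg : gaussMap x ∈ digitSet T :=
        ⟨(gaussMap_mem hx2).1, (gaussMap_mem hx2).2, fun n => cfDigit_succ n x ▸ hx3 (n + 1)⟩
      obtain ⟨i, hi⟩ := mem_iUnion.1 (h1 hg)
      refine mem_iUnion.2 ⟨Nat.pair (cfDigit 0 x) i, ?_⟩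
      simp only [Nat.unpair_pair, t', if_pos (hx3 0)]
      exact ⟨_, hi, (eq_inv_digit hx1).symm⟩
    · intro k
      simp only [t']
      split_ifs with h
      · rintro _ ⟨u, hu, rfl⟩
        have := hT _ h
        have h' : (2 : ℝ) ≤ ((Nat.unpair k).1 : ℝ) := by exact_mod_cast this
        have hu0 := (h2 _ hu).1
        constructor
        · positivity
        · exact inv_le_one_of_one_le₀ (by linarith)
      · simp
    · intro k
      simp only [t']
      split_ifs with h
      · refine (hd _ h _).trans ?_
        rw [pow_succ (2⁻¹ : ENNReal) n, mul_comm]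
        refine mul_le_mul' (h3 _) ?_
        · rw [← ENNReal.ofReal_ofNat, ← ENNReal.ofReal_inv_of_pos (by norm_num)]
          apply ENNReal.ofReal_le_ofReal
          have h' : (2 : ℝ) ≤ ((Nat.unpair k).1 : ℝ) := by exact_mod_cast hT _ h
          gcongr
          nlinarith
      · simp
    · exact (Equiv.tsum_eq Nat.pairEquiv.symm (fun p => Metric.ediam (t' p) ^ s)).trans_le hsum

lemma dimH_digitSet_le (T : Set ℕ) (hT : ∀ a ∈ T, 2 ≤ a) (s : NNReal) (hs : 0 < s)
    (hc : ∑' a : ℕ, T.indicator (fun a : ℕ => ENNReal.ofReal (((a : ℝ) ^ 2)⁻¹) ^ (s : ℝ)) a ≤ 1) :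
    dimH (digitSet T) ≤ s := by
  apply dimH_le_of_hausdorffMeasure_ne_top
  choose t h1 h2 h3 h4 using digitSet_cover T hT s (by exact_mod_cast hs) 1 hc
  have := MeasureTheory.Measure.hausdorffMeasure_le_liminf_tsum (s : ℝ) (digitSet T)
    (l := atTop) (fun n : ℕ => (2⁻¹ : ENNReal) ^ n)
    (ENNReal.tendsto_pow_atTop_nhds_zero_of_lt_one (by simp)) t
    (Eventually.of_forall h3) (Eventually.of_forall h1)
  refine ne_top_of_le_ne_top ENNReal.one_ne_top (this.trans ?_)
  have h4' : ∀ n, ∑' i, Metric.ediam (t n i) ^ (s : ℝ) ≤ 1 := fun n => by simpa using h4 n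
  refine (liminf_le_liminf (Eventually.of_forall h4')).trans ?_
  exact (liminf_const _).le

lemma dimH_preimage_iter (F : Set ℝ) (N : ℕ) :
    dimH {x : ℝ | x ∈ Ioo (0 : ℝ) 1 ∧ Irrational x ∧ gaussMap^[N] x ∈ F} ≤ dimH F := by
  induction N with
  | zero => exact dimH_mono fun x hx => hx.2.2
  | succ N ih =>
    set E := {x : ℝ | x ∈ Ioo (0 : ℝ) 1 ∧ Irrational x ∧ gaussMap^[N] x ∈ F}
    have hsub : {x : ℝ | x ∈ Ioo (0 : ℝ) 1 ∧ Irrational x ∧ gaussMap^[N + 1] x ∈ F} ⊆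
        ⋃ a : ℕ, (fun u : ℝ => (((a + 1 : ℕ) : ℝ) + u)⁻¹) '' E := by
      rintro x ⟨hx1, hx2, hx3⟩
      refine mem_iUnion.2 ⟨cfDigit 0 x - 1, gaussMap x,
        ⟨(gaussMap_mem hx2).1, (gaussMap_mem hx2).2, hx3⟩, ?_⟩
      dsimp only
      rw [Nat.sub_add_cancel (one_le_cfDigit_zero hx1)]
      exact (eq_inv_digit hx1).symm
    refine (dimH_mono hsub).trans ?_
    rw [dimH_iUnion]
    refine iSup_le fun a => ?_
    refine le_trans (LipschitzOnWith.dimH_image_le (K := 1) ?_) ih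
    intro u hu v hv
    refine (branch_lip_edist (by omega) hu.1.1.le hv.1.1.le).trans ?_
    gcongr
    rw [ENNReal.coe_one, ENNReal.ofReal_le_one]
    apply inv_le_one_of_one_le₀
    push_cast
    nlinarith [(Nat.cast_nonneg a : (0 : ℝ) ≤ a)]

lemma summable_digits (S : Set ℕ) (α : ℝ) (hα : 1 ≤ α) (hS : HasPolyDensity S α) (s : ℝ)
    (hs : 1 / (2 * α) < s) :
    ∑' a : ℕ, S.indicator (fun a : ℕ => ENNReal.ofReal (((a : ℝ) ^ 2)⁻¹) ^ s) a ≠ ⊤ := by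
  obtain ⟨C₁, C₂, β, hC₁, hC₂, hβ, h⟩ := hS
  have hα0 : 0 < α := by linarith
  have hs0 : 0 < s := lt_trans (by positivity) hs
  obtain ⟨N0, hN0⟩ := eventually_atTop.1 h
  set N1 := max N0 3
  -- counting function
  let c : ℕ → ℕ := fun a => (S ∩ Icc 1 a).ncard
  have hcb : ∀ a, N1 ≤ a → (c a : ℝ) ≤ C₂ * (a : ℝ) ^ (1 / α) := by
    intro a ha
    have h1 := (hN0 a (le_trans (le_max_left _ _) ha)).2
    refine h1.trans (div_le_self (by positivity) ?_)
    apply Real.one_le_rpow _ hβ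
    have h3 : (3 : ℝ) ≤ a := by exact_mod_cast le_trans (le_max_right _ _) ha
    rw [Real.le_log_iff_exp_le (by linarith)]
    linarith [Real.exp_one_lt_three]
  have hcinj : InjOn c (S ∩ Ici N1) := by
    have key : ∀ a b, a < b → b ∈ S → c a < c b := by
      intro a b hab hb
      apply ncard_lt_ncard
      · refine ⟨inter_subset_inter_right _ (Icc_subset_Icc_right hab.le), fun hh => ?_⟩
        have := (hh ⟨hb, by simp; omega⟩ : b ∈ S ∩ Icc 1 a).2.2
        omega
      · exact (finite_Icc 1 b).inter_of_right _
    intro a ha b hb hab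
    rcases lt_trichotomy a b with hl | hl | hl
    · exact absurd hab (key a b hl hb.1).ne
    · exact hl
    · exact absurd hab (key b a hl ha.1).ne'
  have hc1 : ∀ a ∈ S ∩ Ici N1, 1 ≤ c a := by
    intro a ha
    have : 3 ≤ a := le_trans (le_max_right _ _) ha.2
    apply (ncard_pos ((finite_Icc 1 a).inter_of_right _)).2
    exact ⟨a, ha.1, by simp; omega⟩
  set D : ℝ := (C₂ ^ (2 * s * α))
  have hterm : ∀ a ∈ S ∩ Ici N1, (((a : ℝ) ^ 2)⁻¹) ^ s ≤ D * ((c a : ℝ) ^ (2 * s * α))⁻¹ := by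
    intro a ha
    have ha3 : (3 : ℝ) ≤ a := by exact_mod_cast le_trans (le_max_right N0 3) ha.2
    have h1 : (1 : ℝ) ≤ c a := by exact_mod_cast hc1 a ha
    have h2 := hcb a ha.2
    have h3 : (c a : ℝ) ^ (2 * s * α) ≤ D * ((a : ℝ) ^ 2) ^ s := by
      calc (c a : ℝ) ^ (2 * s * α) ≤ (C₂ * (a : ℝ) ^ (1 / α)) ^ (2 * s * α) := by
            apply Real.rpow_le_rpow (by linarith) h2 (by positivity)
        _ = D * ((a : ℝ) ^ 2) ^ s := by
            rw [Real.mul_rpow hC₂.le (by positivity), ← Real.rpow_mul (by positivity),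
              ← Real.rpow_natCast, ← Real.rpow_mul (by positivity)]
            congr 2
            field_simp
            norm_num
    rw [Real.inv_rpow (by positivity), ← div_eq_mul_inv, inv_eq_one_div,
      div_le_div_iff₀ (by positivity) (by positivity)]
    linarith
  have hsumm : Summable (fun n : ℕ => D * ((n : ℝ) ^ (2 * s * α))⁻¹) := by
    apply Summable.mul_left
    apply Real.summable_nat_rpow_inv.2
    rw [div_lt_iff₀ (by positivity)] at hs
    linarith
  have hsummS : Summable (fun a : (S ∩ Ici N1 : Set ℕ) => ((((a : ℕ) : ℝ) ^ 2)⁻¹) ^ s) := by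
    refine Summable.of_nonneg_of_le (fun a => by positivity) (fun a => hterm a a.2) ?_
    exact hsumm.comp_injective (i := fun a : (S ∩ Ici N1 : Set ℕ) => c a)
      (fun a b hab => Subtype.ext (hcinj a.2 b.2 hab))
  have hsub : ∑' a : ℕ, S.indicator (fun a : ℕ => ENNReal.ofReal (((a : ℝ) ^ 2)⁻¹) ^ s) a ≤
      ∑' a : ℕ, (S ∩ Ici N1).indicator (fun a : ℕ => ENNReal.ofReal (((a : ℝ) ^ 2)⁻¹) ^ s) a +
      ∑' a : ℕ, (Iio N1).indicator (fun a : ℕ => ENNReal.ofReal (((a : ℝ) ^ 2)⁻¹) ^ s) a := by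
    rw [← ENNReal.tsum_add]
    apply ENNReal.tsum_le_tsum
    intro a
    by_cases h1 : a ∈ S
    · by_cases h2 : N1 ≤ a
      · rw [indicator_of_mem h1, indicator_of_mem (show a ∈ S ∩ Ici N1 from ⟨h1, h2⟩)]
        exact le_self_add
      · rw [indicator_of_mem h1, indicator_of_mem (show a ∈ Iio N1 from not_le.1 h2)]
        exact le_add_self
    · simp [h1]
  refine ne_top_of_le_ne_top (ENNReal.add_ne_top.2 ⟨?_, ?_⟩) hsub
  · rw [← tsum_subtype]
    have := hsummS.tsum_ofReal_ne_top
    convert this using 3 with a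
    rw [ENNReal.ofReal_rpow_of_nonneg (by positivity) hs0.le]
  · rw [tsum_eq_sum (s := Finset.range N1)]
    · apply (ENNReal.sum_lt_top.2 _).ne
      intro a _
      refine lt_of_le_of_lt (indicator_le_self _ _ _) ?_
      exact ENNReal.rpow_lt_top_of_nonneg hs0.le ENNReal.ofReal_ne_top
    · intro b hb
      apply indicator_of_notMem
      simpa using hb

lemma dimH_distinct_le (S : Set ℕ) (α : ℝ) (hα : 1 ≤ α) (hS : HasPolyDensity S α) :
    dimH {x : ℝ | x ∈ Set.Ioo (0 : ℝ) 1 ∧ Irrational x ∧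
        (∀ m n : ℕ, m ≠ n → cfDigit m x ≠ cfDigit n x) ∧ ∀ n : ℕ, cfDigit n x ∈ S} ≤
      ENNReal.ofReal (1 / (2 * α)) := by
  have hα0 : 0 < α := by linarith
  apply ENNReal.le_of_forall_pos_le_add
  intro ε hε _
  set s : NNReal := Real.toNNReal (1 / (2 * α)) + ε with hsdef
  have hs0 : 0 < s := by positivity
  have hsr : 1 / (2 * α) < (s : ℝ) := by
    rw [hsdef, NNReal.coe_add, Real.coe_toNNReal _ (by positivity)]
    have : (0 : ℝ) < ε := hε
    linarith
  have htop := summable_digits S α hα hS s hsr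
  have hlim := ENNReal.tendsto_tsum_compl_atTop_zero htop
  have hev := (hlim.eventually (ge_mem_nhds (zero_lt_one (α := ENNReal)))).and
    (eventually_ge_atTop ({0, 1} : Finset ℕ))
  obtain ⟨F, hF1, hF2⟩ := hev.exists
  set T : Set ℕ := S \ F
  have hT : ∀ a ∈ T, 2 ≤ a := by
    intro a ha
    have h : a ∉ ({0, 1} : Finset ℕ) := fun h => ha.2 (hF2 h)
    simp at h
    omega
  have hdim : dimH (digitSet T) ≤ s := by
    apply dimH_digitSet_le T hT s hs0
    refine le_trans (le_of_eq ?_) hF1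
    have := tsum_subtype (((F : Set ℕ))ᶜ)
      (S.indicator (fun a : ℕ => ENNReal.ofReal (((a : ℝ) ^ 2)⁻¹) ^ (s : ℝ)))
    rw [indicator_indicator] at this
    have h2 : T = (F : Set ℕ)ᶜ ∩ S := by ext; simp [T, and_comm]
    rw [h2, ← this]
    rfl
  have hsub : {x : ℝ | x ∈ Set.Ioo (0 : ℝ) 1 ∧ Irrational x ∧
        (∀ m n : ℕ, m ≠ n → cfDigit m x ≠ cfDigit n x) ∧ ∀ n : ℕ, cfDigit n x ∈ S} ⊆
      ⋃ N : ℕ, {x : ℝ | x ∈ Ioo (0 : ℝ) 1 ∧ Irrational x ∧ gaussMap^[N] x ∈ digitSet T} := by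
    rintro x ⟨hx1, hx2, hx3, hx4⟩
    have hinj : Function.Injective (fun n => cfDigit n x) := by
      intro m n hmn
      by_contra hne
      exact hx3 m n hne hmn
    have hcof := hinj.tendsto_cofinite.eventually (F.finite_toSet.compl_mem_cofinite)
    rw [Nat.cofinite_eq_atTop] at hcof
    obtain ⟨N, hN⟩ := eventually_atTop.1 hcof
    have hit : ∀ k, gaussMap^[k] x ∈ Ioo (0 : ℝ) 1 ∧ Irrational (gaussMap^[k] x) := by
      intro k
      induction k with
      | zero => exact ⟨hx1, hx2⟩
      | succ k ih =>
        rw [Function.iterate_succ_apply']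
        exact gaussMap_mem ih.2
    refine mem_iUnion.2 ⟨N, hx1, hx2, (hit N).1, (hit N).2, fun n => ?_⟩
    have : cfDigit n (gaussMap^[N] x) = cfDigit (n + N) x := by
      simp [cfDigit, Function.iterate_add_apply]
    rw [this]
    exact ⟨hx4 _, hN _ (by omega)⟩
  refine (dimH_mono hsub).trans ?_
  rw [dimH_iUnion]
  refine iSup_le fun N => ((dimH_preimage_iter _ N).trans hdim).trans ?_
  rw [hsdef, ENNReal.coe_add]
  rfl

/-! ### Continued fractions with prescribed digits -/

/-- Finite continued fraction `[0; a 0, ..., a (n-1)]`. -/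
noncomputable def cfApp : ℕ → (ℕ → ℕ) → ℝ
  | 0, _ => 0
  | n + 1, a => ((a 0 : ℝ) + cfApp n (fun i => a (i + 1)))⁻¹

/-- Value of the infinite continued fraction. -/
noncomputable def cfVal (a : ℕ → ℕ) : ℝ := limUnder atTop (fun n => cfApp n a)

lemma cfApp_nonneg (n : ℕ) : ∀ a : ℕ → ℕ, 0 ≤ cfApp n a := by
  induction n with
  | zero => intro a; simp [cfApp]
  | succ n ih =>
    intro a
    have := ih (fun i => a (i + 1))
    simp only [cfApp]
    positivity

lemma cfApp_sub (n : ℕ) : ∀ a : ℕ → ℕ, (∀ i, 2 ≤ a i) →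
    |cfApp n a - cfApp (n + 1) a| ≤ 1 * (1 / 2 : ℝ) ^ n := by
  induction n with
  | zero =>
    intro a ha
    have h2 : (2 : ℝ) ≤ a 0 := by exact_mod_cast ha 0
    simp only [cfApp]
    simp only [add_zero, zero_sub, abs_neg, pow_zero, mul_one]
    rw [abs_of_nonneg (by positivity)]
    exact inv_le_one_of_one_le₀ (by linarith)
  | succ n ih =>
    intro a ha
    have h2 : (2 : ℝ) ≤ a 0 := by exact_mod_cast ha 0
    have h := ih (fun i => a (i + 1)) (fun i => ha _)
    have h' := branch_lip_s13 (a := a 0) (by linarith [ha 0]) (cfApp_nonneg n (fun i => a (i + 1)))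
      (cfApp_nonneg (n + 1) (fun i => a (i + 1)))
    calc |cfApp (n + 1) a - cfApp (n + 1 + 1) a| ≤ _ := h'
      _ ≤ (2 : ℝ)⁻¹ * (1 * (1 / 2 : ℝ) ^ n) := by
        gcongr
        nlinarith
      _ = 1 * (1 / 2 : ℝ) ^ (n + 1) := by rw [pow_succ]; ring

lemma cfVal_tendsto {a : ℕ → ℕ} (ha : ∀ i, 2 ≤ a i) :
    Tendsto (fun n => cfApp n a) atTop (nhds (cfVal a)) := by
  apply CauchySeq.tendsto_limUnder
  apply cauchySeq_of_le_geometric (1 / 2 : ℝ) 1 (by norm_num)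
  intro n
  rw [Real.dist_eq]
  exact cfApp_sub n a ha

lemma cfVal_nonneg {a : ℕ → ℕ} (ha : ∀ i, 2 ≤ a i) : 0 ≤ cfVal a :=
  ge_of_tendsto' (cfVal_tendsto ha) (fun n => cfApp_nonneg n a)

lemma cfVal_eq {a : ℕ → ℕ} (ha : ∀ i, 2 ≤ a i) :
    cfVal a = ((a 0 : ℝ) + cfVal (fun i => a (i + 1)))⁻¹ := by
  have h1 := (tendsto_add_atTop_iff_nat 1).2 (cfVal_tendsto ha)
  have h2 : ∀ i, 2 ≤ (fun i => a (i + 1)) i := fun i => ha _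
  have h3 : (2 : ℝ) ≤ a 0 := by exact_mod_cast ha 0
  have h4 := cfVal_nonneg h2
  exact tendsto_nhds_unique h1 (((cfVal_tendsto h2).const_add _).inv₀ (by positivity))

lemma cfVal_mem {a : ℕ → ℕ} (ha : ∀ i, 2 ≤ a i) : 0 < cfVal a ∧ cfVal a ≤ 1 / 2 := by
  have h2 : ∀ i, 2 ≤ (fun i => a (i + 1)) i := fun i => ha _
  have h3 : (2 : ℝ) ≤ a 0 := by exact_mod_cast ha 0
  have h4 := cfVal_nonneg h2
  rw [cfVal_eq ha]
  constructor
  · positivity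
  · rw [one_div]
    gcongr
    linarith

lemma gaussMap_cfVal {a : ℕ → ℕ} (ha : ∀ i, 2 ≤ a i) :
    gaussMap (cfVal a) = cfVal (fun i => a (i + 1)) := by
  have h2 : ∀ i, 2 ≤ (fun i => a (i + 1)) i := fun i => ha _
  have h4 := cfVal_mem h2
  rw [cfVal_eq ha, gaussMap, inv_inv, Int.fract_natCast_add, Int.fract_eq_self]
  exact ⟨h4.1.le, by linarith [h4.2]⟩

lemma gaussMap_iter_cfVal (n : ℕ) : ∀ {a : ℕ → ℕ}, (∀ i, 2 ≤ a i) →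
    gaussMap^[n] (cfVal a) = cfVal (fun i => a (i + n)) := by
  induction n with
  | zero => intro a _; rfl
  | succ n ih =>
    intro a ha
    rw [Function.iterate_succ_apply, gaussMap_cfVal ha, ih (fun i => ha _)]
    congr 1

lemma cfDigit_cfVal (n : ℕ) {a : ℕ → ℕ} (ha : ∀ i, 2 ≤ a i) : cfDigit n (cfVal a) = a n := by
  have h1 : ∀ i, 2 ≤ (fun i => a (i + n)) i := fun i => ha _
  have h2 : ∀ i, 2 ≤ (fun i => a (i + 1 + n)) i := fun i => ha _
  have h4 := cfVal_mem h2
  rw [cfDigit, gaussMap_iter_cfVal n ha, cfVal_eq h1, inv_inv]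
  simp only [zero_add]
  rw [Nat.floor_eq_iff (add_nonneg (Nat.cast_nonneg _) h4.1.le)]
  constructor <;> linarith [h4.1, h4.2]

lemma rational_terminates (q : ℕ) : ∀ p : ℕ, ∀ x : ℝ, x = (p : ℝ) / q →
    (∀ n, gaussMap^[n] x ∈ Ioo (0 : ℝ) 1) → False := by
  induction q using Nat.strong_induction_on with
  | _ q ih =>
    intro p x hx h
    have h0 := h 0
    simp only [Function.iterate_zero, id] at h0
    have hq : 0 < q := by
      rcases Nat.eq_zero_or_pos q with h' | h'
      · subst h'
        simp [hx] at h0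
      · exact h'
    have hq' : (0 : ℝ) < q := by exact_mod_cast hq
    have hpq : p < q := by
      have := h0.2
      rw [hx, div_lt_one hq'] at this
      exact_mod_cast this
    refine ih p hpq (q % p) (gaussMap x) ?_ ?_
    · rw [gaussMap, hx, inv_div]
      exact Int.fract_div_natCast_eq_div_natCast_mod
    · intro n
      have := h (n + 1)
      rwa [Function.iterate_succ_apply] at this

lemma irrational_cfVal {a : ℕ → ℕ} (ha : ∀ i, 2 ≤ a i) : Irrational (cfVal a) := by
  rintro ⟨r, hr⟩
  have hmem := cfVal_mem ha
  have hr0 : 0 < r := by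
    have : (0 : ℝ) < r := by rw [hr]; exact hmem.1
    exact_mod_cast this
  refine rational_terminates r.den r.num.toNat (cfVal a) ?_ ?_
  · rw [← hr]
    have hn : ((r.num.toNat : ℕ) : ℤ) = r.num := Int.toNat_of_nonneg (Rat.num_pos.2 hr0).le
    have hn' : ((r.num.toNat : ℕ) : ℝ) = ((r.num : ℤ) : ℝ) := by exact_mod_cast congrArg (Int.cast (R := ℝ)) hn
    rw [hn']
    exact Rat.cast_def r
  · intro n
    rw [gaussMap_iter_cfVal n ha]
    have := cfVal_mem (a := fun i => a (i + n)) (fun i => ha _)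
    exact ⟨this.1, by linarith [this.2]⟩

lemma cfVal_gap (n : ℕ) : ∀ (a b B : ℕ → ℕ), (∀ i, 2 ≤ a i) → (∀ i, 2 ≤ b i) →
    (∀ i, a i + 1 ≤ B i) → (∀ i, b i + 1 ≤ B i) → (∀ i < n, a i = b i) → a n ≠ b n →
    (1 / 2 : ℝ) * ∏ i ∈ Finset.range (n + 1), ((B i : ℝ) ^ 2)⁻¹ ≤ |cfVal a - cfVal b| := by
  induction n with
  | zero =>
    intro a b B ha hb haB hbB _ hne
    have hu := cfVal_mem (a := fun i => a (i + 1)) (fun i => ha _)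
    have hv := cfVal_mem (a := fun i => b (i + 1)) (fun i => hb _)
    have ha2 : (2 : ℝ) ≤ a 0 := by exact_mod_cast ha 0
    have hb2 : (2 : ℝ) ≤ b 0 := by exact_mod_cast hb 0
    have haB' : (a 0 : ℝ) + 1 ≤ B 0 := by exact_mod_cast haB 0
    have hbB' : (b 0 : ℝ) + 1 ≤ B 0 := by exact_mod_cast hbB 0
    rw [cfVal_eq ha, cfVal_eq hb]
    set u := cfVal (fun i => a (i + 1))
    set v := cfVal (fun i => b (i + 1))
    have hpa : 0 < (a 0 : ℝ) + u := by linarith [hu.1]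
    have hpb : 0 < (b 0 : ℝ) + v := by linarith [hv.1]
    rw [inv_sub_inv hpa.ne' hpb.ne', abs_div, abs_of_pos (mul_pos hpa hpb)]
    have hnum : (1 / 2 : ℝ) ≤ |(b 0 : ℝ) + v - ((a 0 : ℝ) + u)| := by
      rcases lt_or_gt_of_ne hne with h | h
      · have : (a 0 : ℝ) + 1 ≤ b 0 := by exact_mod_cast h
        exact le_trans (by linarith [hu.2, hv.1]) (le_abs_self _)
      · have : (b 0 : ℝ) + 1 ≤ a 0 := by exact_mod_cast h
        exact le_trans (by linarith [hv.2, hu.1]) (neg_le_abs _)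
    simp only [zero_add, Finset.prod_range_one]
    rw [div_eq_mul_inv _ (((a 0 : ℝ) + u) * _)]
    gcongr
    rw [sq]
    gcongr
    · linarith [hu.2]
    · linarith [hv.2]
  | succ n ih =>
    intro a b B ha hb haB hbB heq hne
    have hu := cfVal_mem (a := fun i => a (i + 1)) (fun i => ha _)
    have hv := cfVal_mem (a := fun i => b (i + 1)) (fun i => hb _)
    have ha2 : (2 : ℝ) ≤ a 0 := by exact_mod_cast ha 0
    have haB' : (a 0 : ℝ) + 1 ≤ B 0 := by exact_mod_cast haB 0
    have h := ih (fun i => a (i + 1)) (fun i => b (i + 1)) (fun i => B (i + 1))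
      (fun i => ha _) (fun i => hb _) (fun i => haB _) (fun i => hbB _)
      (fun i hi => heq _ (by omega)) hne
    rw [cfVal_eq ha, cfVal_eq hb, ← heq 0 (by omega),
      branch_sub (by linarith [ha 0]) hu.1.le hv.1.le, Finset.prod_range_succ', ← mul_assoc,
      div_eq_mul_inv]
    refine mul_le_mul h ?_ (by positivity) (abs_nonneg _)
    have hpa : 0 < (a 0 : ℝ) + cfVal (fun i => a (i + 1)) := by linarith [hu.1]
    have hpb : 0 < (a 0 : ℝ) + cfVal (fun i => b (i + 1)) := by linarith [hv.1]
    rw [sq]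
    gcongr
    · linarith [hu.2]
    · linarith [hv.2]

/-! ### Mixed radix expansion -/

/-- Remainders of the mixed radix expansion. -/
noncomputable def radRem (m : ℕ → ℕ) (y : ℝ) : ℕ → ℝ
  | 0 => y
  | n + 1 => Int.fract ((m n : ℝ) * radRem m y n)

/-- Digits of the mixed radix expansion. -/
noncomputable def radDigit (m : ℕ → ℕ) (y : ℝ) (n : ℕ) : ℕ := ⌊(m n : ℝ) * radRem m y n⌋₊

lemma radRem_mem (m : ℕ → ℕ) {y : ℝ} (hy : y ∈ Ico (0 : ℝ) 1) (n : ℕ) :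
    radRem m y n ∈ Ico (0 : ℝ) 1 := by
  cases n with
  | zero => exact hy
  | succ n => exact ⟨Int.fract_nonneg _, Int.fract_lt_one _⟩

lemma radDigit_lt (m : ℕ → ℕ) (hm : ∀ i, 2 ≤ m i) {y : ℝ} (hy : y ∈ Ico (0 : ℝ) 1) (n : ℕ) :
    radDigit m y n < m n := by
  have h := radRem_mem m hy n
  have hm' : (2 : ℝ) ≤ m n := by exact_mod_cast hm n
  rw [radDigit, Nat.floor_lt (mul_nonneg (by linarith) h.1)]
  nlinarith [h.2]

lemma radRem_succ (m : ℕ → ℕ) {y : ℝ} (hy : y ∈ Ico (0 : ℝ) 1) (n : ℕ) :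
    radRem m y (n + 1) = (m n : ℝ) * radRem m y n - radDigit m y n := by
  have h := radRem_mem m hy n
  rw [radRem, radDigit, natCast_floor_eq_intCast_floor (mul_nonneg (Nat.cast_nonneg _) h.1)]
  rfl

lemma rad_sub (m : ℕ → ℕ) {y z : ℝ} (hy : y ∈ Ico (0 : ℝ) 1)
    (hz : z ∈ Ico (0 : ℝ) 1) (n : ℕ) (heq : ∀ i < n, radDigit m y i = radDigit m z i) :
    (y - z) * ∏ i ∈ Finset.range n, (m i : ℝ) = radRem m y n - radRem m z n := by
  induction n with
  | zero => simp [radRem]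
  | succ n ih =>
    rw [radRem_succ m hy, radRem_succ m hz, heq n (by omega), Finset.prod_range_succ, ← mul_assoc,
      ih (fun i hi => heq i (by omega))]
    ring

lemma rad_abs_sub (m : ℕ → ℕ) {y z : ℝ} (hy : y ∈ Ico (0 : ℝ) 1)
    (hz : z ∈ Ico (0 : ℝ) 1) (n : ℕ) (heq : ∀ i < n, radDigit m y i = radDigit m z i) :
    |y - z| * ∏ i ∈ Finset.range n, (m i : ℝ) ≤ 1 := by
  have h := rad_sub m hy hz n heq
  have h1 := radRem_mem m hy n
  have h2 := radRem_mem m hz n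
  have h3 : (0 : ℝ) ≤ ∏ i ∈ Finset.range n, (m i : ℝ) := Finset.prod_nonneg fun i _ => by positivity
  rw [← abs_of_nonneg h3, ← abs_mul, h, abs_le]
  constructor <;> linarith [h1.1, h1.2, h2.1, h2.2]

lemma rad_exists_ne (m : ℕ → ℕ) (hm : ∀ i, 2 ≤ m i) {y z : ℝ} (hy : y ∈ Ico (0 : ℝ) 1)
    (hz : z ∈ Ico (0 : ℝ) 1) (hne : y ≠ z) :
    ∃ n, (∀ i < n, radDigit m y i = radDigit m z i) ∧ radDigit m y n ≠ radDigit m z n := by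
  classical
  have hex : ∃ n, radDigit m y n ≠ radDigit m z n := by
    by_contra! hcon
    have hpos : 0 < |y - z| := abs_pos.2 (sub_ne_zero.2 hne)
    obtain ⟨n, hn⟩ := pow_unbounded_of_one_lt (1 / |y - z|) (one_lt_two (α := ℝ))
    have h1 := rad_abs_sub m hy hz n (fun i _ => hcon i)
    have h2 : (2 : ℝ) ^ n ≤ ∏ i ∈ Finset.range n, (m i : ℝ) := by
      have := Finset.prod_le_prod (s := Finset.range n) (f := fun _ => (2 : ℝ))
        (g := fun i => (m i : ℝ)) (fun i _ => by norm_num) (fun i _ => by exact_mod_cast hm i)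
      simpa using this
    rw [div_lt_iff₀ hpos] at hn
    nlinarith
  exact ⟨Nat.find hex, fun i hi => not_not.1 (Nat.find_min hex hi), Nat.find_spec hex⟩

/-! ### Lower bound -/

lemma lower_of_blocks (S : Set ℕ) (K L : ℕ) (hK : 2 ≤ K) (hL : 1 ≤ L) (γ s : ℝ) (hs : 0 < s)
    (hsγ : s < γ / 2)
    (h : ∀ i, 2 ≤ (S ∩ Ioc (K ^ (i + L)) (K ^ (i + L + 1))).ncard ∧
      ((K ^ (i + L) : ℕ) : ℝ) ^ γ ≤ ((S ∩ Ioc (K ^ (i + L)) (K ^ (i + L + 1))).ncard : ℝ)) :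
    ENNReal.ofReal s ≤ dimH {x : ℝ | x ∈ Set.Ioo (0 : ℝ) 1 ∧ Irrational x ∧
        StrictMono (fun n : ℕ => cfDigit n x) ∧ ∀ n : ℕ, cfDigit n x ∈ S} := by
  set m : ℕ → ℕ := fun i => (S ∩ Ioc (K ^ (i + L)) (K ^ (i + L + 1))).ncard with hmdef
  have hm : ∀ i, 2 ≤ m i := fun i => (h i).1
  have hγ : 0 < γ := by linarith
  have hKr : (2 : ℝ) ≤ K := by exact_mod_cast hK
  have hK0 : (0 : ℝ) < K := by linarith
  have hK1 : (1 : ℝ) ≤ K := by linarith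
  have hchoice : ∀ i, ∃ e : ℕ → ℕ,
      (∀ d < m i, e d ∈ S ∩ Ioc (K ^ (i + L)) (K ^ (i + L + 1))) ∧
      (∀ d < m i, ∀ d' < m i, e d = e d' → d = d') := by
    intro i
    have hfin : (S ∩ Ioc (K ^ (i + L)) (K ^ (i + L + 1))).Finite :=
      (finite_Ioc _ _).inter_of_right _
    have hcard : hfin.toFinset.card = m i := (ncard_eq_toFinset_card _ hfin).symm
    let o := hfin.toFinset.orderEmbOfFin hcard
    refine ⟨fun d => if hd : d < m i then o ⟨d, hd⟩ else 0, ?_, ?_⟩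
    · intro d hd
      simp only [dif_pos hd]
      exact hfin.mem_toFinset.1 (Finset.orderEmbOfFin_mem _ hcard ⟨d, hd⟩)
    · intro d hd d' hd' hdd
      simp only [dif_pos hd, dif_pos hd'] at hdd
      simpa using o.injective hdd
  choose e he1 he2 using hchoice
  -- the digits attached to `y`
  let A : ℝ → ℕ → ℕ := fun y i => e i (radDigit m y i)
  have hA : ∀ y ∈ Ico (0 : ℝ) 1, ∀ i, A y i ∈ S ∩ Ioc (K ^ (i + L)) (K ^ (i + L + 1)) :=
    fun y hy i => he1 i _ (radDigit_lt m hm hy i)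
  have hA2 : ∀ y ∈ Ico (0 : ℝ) 1, ∀ i, 2 ≤ A y i := by
    intro y hy i
    have h1 := (hA y hy i).2.1
    have h2 : 1 ≤ K ^ (i + L) := Nat.one_le_pow _ _ (by omega)
    omega
  let Ψ : ℝ → ℝ := fun y => cfVal (A y)
  let B : ℕ → ℕ := fun i => K ^ (i + L + 2)
  have hAB : ∀ y ∈ Ico (0 : ℝ) 1, ∀ i, A y i + 1 ≤ B i := by
    intro y hy i
    have h1 := (hA y hy i).2.2
    have h2 : 1 ≤ K ^ (i + L + 1) := Nat.one_le_pow _ _ (by omega)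
    have h3 : B i = K ^ (i + L + 1) * K := by simp only [B]; ring
    rw [h3]
    nlinarith
  have hBprod : ∀ k, ∏ i ∈ Finset.range k, ((B i : ℝ) ^ 2)⁻¹ =
      ((K : ℝ) ^ ((k : ℝ) * (k + 2 * L + 3)))⁻¹ := by
    intro k
    induction k with
    | zero => simp
    | succ k ih =>
      rw [Finset.prod_range_succ, ih, ← mul_inv]
      congr 1
      have : ((B k : ℝ) ^ 2) = (K : ℝ) ^ ((2 * (k + L + 2) : ℝ)) := by
        have h' : (2 * (k + L + 2) : ℝ) = ((2 * (k + L + 2) : ℕ) : ℝ) := by push_cast; ring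
        rw [h', Real.rpow_natCast]
        simp only [B]
        push_cast
        ring
      rw [this, ← Real.rpow_add hK0]
      congr 1
      push_cast
      ring
  have hmprod : ∀ k : ℕ, (K : ℝ) ^ (γ * ((k : ℝ) * (k - 1) / 2)) ≤
      ∏ i ∈ Finset.range k, (m i : ℝ) := by
    intro k
    induction k with
    | zero => simp
    | succ k ih =>
      rw [Finset.prod_range_succ]
      have h1 : (K : ℝ) ^ (γ * (((k + 1 : ℕ) : ℝ) * ((k + 1 : ℕ) - 1) / 2)) =
          (K : ℝ) ^ (γ * ((k : ℝ) * (k - 1) / 2)) * (K : ℝ) ^ (γ * k) := by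
        rw [← Real.rpow_add hK0]
        congr 1
        push_cast
        ring
      rw [h1]
      refine mul_le_mul ih ?_ (by positivity) (Finset.prod_nonneg fun i _ => by positivity)
      refine le_trans ?_ (h k).2
      push_cast
      rw [← Real.rpow_natCast, ← Real.rpow_mul hK0.le]
      apply Real.rpow_le_rpow_of_exponent_le hK1
      push_cast
      nlinarith [(Nat.cast_nonneg L : (0 : ℝ) ≤ L)]
  set δ : ℝ := γ / 2 - s with hδ
  have hδ0 : 0 < δ := by linarith
  set P : ℝ := s * (2 * L + 5) + γ / 2 with hP
  set D : ℝ := P ^ 2 / (4 * δ) + s * (2 * L + 4) with hD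
  have hquad : ∀ n : ℝ, s * ((n + 1) * (n + 1 + 2 * L + 3)) - γ * (n * (n - 1) / 2) ≤ D := by
    intro n
    have h1 : δ * (n - P / (2 * δ)) ^ 2 = δ * n ^ 2 - P * n + P ^ 2 / (4 * δ) := by
      field_simp
      ring
    have h2 : 0 ≤ δ * (n - P / (2 * δ)) ^ 2 := by positivity
    have h3 : s * ((n + 1) * (n + 1 + 2 * L + 3)) - γ * (n * (n - 1) / 2) =
      D - δ * (n - P / (2 * δ)) ^ 2 := by
      rw [h1, hD, hδ, hP]
      ring
    linarith
  set C : ℝ := 2 ^ s * (K : ℝ) ^ D with hC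
  have hC0 : 0 < C := by positivity
  have hkey : ∀ y ∈ Ico (0 : ℝ) 1, ∀ z ∈ Ico (0 : ℝ) 1, |y - z| ≤ C * |Ψ y - Ψ z| ^ s := by
    intro y hy z hz
    by_cases hne : y = z
    · subst hne
      simp
      positivity
    obtain ⟨n, hn1, hn2⟩ := rad_exists_ne m hm hy hz hne
    have hgap := cfVal_gap n (A y) (A z) B (hA2 y hy) (hA2 z hz) (hAB y hy) (hAB z hz)
      (fun i hi => by simp only [A, hn1 i hi])
      (fun hcon => hn2 (he2 n _ (radDigit_lt m hm hy n) _ (radDigit_lt m hm hz n) hcon))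
    rw [hBprod] at hgap
    have hup := rad_abs_sub m hy hz n hn1
    have hup2 : |y - z| ≤ (K : ℝ) ^ (-(γ * ((n : ℝ) * (n - 1) / 2))) := by
      rw [Real.rpow_neg hK0.le, ← one_div, le_div_iff₀ (by positivity)]
      exact le_trans (mul_le_mul_of_nonneg_left (hmprod n) (abs_nonneg _)) hup
    refine hup2.trans ?_
    calc (K : ℝ) ^ (-(γ * ((n : ℝ) * (n - 1) / 2)))
        ≤ (K : ℝ) ^ (D + (-(((n + 1 : ℕ) : ℝ) * ((n + 1 : ℕ) + 2 * L + 3))) * s) := by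
          apply Real.rpow_le_rpow_of_exponent_le hK1
          push_cast
          linarith [hquad n]
      _ = C * ((1 / 2 : ℝ) * ((K : ℝ) ^ (((n + 1 : ℕ) : ℝ) * ((n + 1 : ℕ) + 2 * L + 3)))⁻¹) ^ s := by
          rw [Real.rpow_add hK0, Real.rpow_mul hK0.le, Real.rpow_neg hK0.le,
            Real.mul_rpow (by norm_num) (inv_nonneg.2 (Real.rpow_nonneg hK0.le _)), hC]
          have : (2 : ℝ) ^ s * (1 / 2 : ℝ) ^ s = 1 := by
            rw [← Real.mul_rpow (by norm_num) (by norm_num)]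
            norm_num
          linear_combination (-(K : ℝ) ^ D *
            (((K : ℝ) ^ (((n + 1 : ℕ) : ℝ) * ((n + 1 : ℕ) + 2 * L + 3)))⁻¹) ^ s) * this
      _ ≤ C * |Ψ y - Ψ z| ^ s := by
          gcongr
  have hinj : InjOn Ψ (Ico 0 1) := by
    intro y hy z hz hyz
    have := hkey y hy z hz
    rw [hyz, sub_self, abs_zero, Real.zero_rpow hs.ne', mul_zero] at this
    exact sub_eq_zero.1 (abs_eq_zero.1 (le_antisymm this (abs_nonneg _)))
  have hleft := hinj.leftInvOn_invFunOn
  set g := Function.invFunOn Ψ (Ico (0 : ℝ) 1)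
  have hholder : HolderOnWith C.toNNReal s.toNNReal g (Ψ '' Ico 0 1) := by
    rintro _ ⟨y, hy, rfl⟩ _ ⟨z, hz, rfl⟩
    rw [hleft hy, hleft hz, edist_dist, edist_dist, Real.coe_toNNReal _ hs.le,
      ENNReal.ofReal_rpow_of_nonneg dist_nonneg hs.le]
    change _ ≤ ENNReal.ofReal C * _
    rw [← ENNReal.ofReal_mul hC0.le]
    apply ENNReal.ofReal_le_ofReal
    simpa [Real.dist_eq] using hkey y hy z hz
  have hdim := hholder.dimH_image_le (Real.toNNReal_pos.2 hs)
  have himg : g '' (Ψ '' Ico 0 1) = Ico 0 1 := hleft.image_image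
  rw [himg, Real.dimH_of_nonempty_interior (by simp)] at hdim
  simp only [Module.finrank_self, Nat.cast_one] at hdim
  rw [ENNReal.le_div_iff_mul_le (Or.inl (by simpa using hs)) (Or.inl (by simp)), one_mul] at hdim
  refine le_trans hdim (dimH_mono ?_)
  rintro _ ⟨y, hy, rfl⟩
  have hdig : ∀ n, cfDigit n (Ψ y) = A y n := fun n => cfDigit_cfVal n (hA2 y hy)
  have hmem := cfVal_mem (hA2 y hy)
  refine ⟨⟨hmem.1, lt_of_le_of_lt hmem.2 (by norm_num)⟩, irrational_cfVal (hA2 y hy), ?_, ?_⟩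
  · apply strictMono_nat_of_lt_succ
    intro n
    rw [hdig, hdig]
    have h1 := (hA y hy n).2.2
    have h2 := (hA y hy (n + 1)).2.1
    rw [show n + 1 + L = n + L + 1 by ring] at h2
    omega
  · intro n
    rw [hdig]
    exact (hA y hy n).1

lemma exists_blocks (S : Set ℕ) (α : ℝ) (hα : 1 ≤ α) (hS : HasPolyDensity S α) (γ : ℝ)
    (hγ0 : 0 < γ) (hγ : γ < 1 / α) :
    ∃ K L : ℕ, 2 ≤ K ∧ 1 ≤ L ∧ ∀ i, 2 ≤ (S ∩ Ioc (K ^ (i + L)) (K ^ (i + L + 1))).ncard ∧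
      ((K ^ (i + L) : ℕ) : ℝ) ^ γ ≤ ((S ∩ Ioc (K ^ (i + L)) (K ^ (i + L + 1))).ncard : ℝ) := by
  obtain ⟨C₁, C₂, β, hC₁, hC₂, hβ, h⟩ := hS
  have hα0 : 0 < α := by linarith
  set p : ℝ := 1 / α with hp
  have hp0 : 0 < p := by positivity
  -- choice of `K`
  obtain ⟨K, hKbig, hK⟩ : ∃ K : ℕ, (C₂ + 1) * 2 ^ β / C₁ ≤ (K : ℝ) ^ p ∧ 2 ≤ K := by
    have h1 : Tendsto (fun K : ℕ => (K : ℝ) ^ p) atTop atTop :=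
      (tendsto_rpow_atTop hp0).comp tendsto_natCast_atTop_atTop
    exact ((h1.eventually_ge_atTop _).and (eventually_ge_atTop 2)).exists
  have hKr : (2 : ℝ) ≤ K := by exact_mod_cast hK
  have hK0 : (0 : ℝ) < K := by linarith
  have hpow : Tendsto (fun j : ℕ => K ^ j) atTop atTop := tendsto_pow_atTop_atTop_of_one_lt (by omega)
  have hpowr : Tendsto (fun j : ℕ => ((K ^ j : ℕ) : ℝ)) atTop atTop :=
    tendsto_natCast_atTop_atTop.comp hpow
  have hlog : ∀ᶠ j : ℕ in atTop, (Real.log ((K ^ j : ℕ) : ℝ)) ^ β ≤ ((K ^ j : ℕ) : ℝ) ^ (p - γ) := by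
    have h1 := (isLittleO_log_rpow_rpow_atTop β (sub_pos.2 hγ)).bound (zero_lt_one (α := ℝ))
    filter_upwards [hpowr.eventually h1, eventually_ge_atTop 0] with j hj _
    rw [one_mul] at hj
    refine le_trans (le_abs_self _) (hj.trans (le_of_eq ?_))
    rw [Real.norm_eq_abs, abs_of_nonneg (by positivity)]
  have hge2 : ∀ᶠ j : ℕ in atTop, (2 : ℝ) ≤ ((K ^ j : ℕ) : ℝ) ^ γ :=
    ((tendsto_rpow_atTop hγ0).comp hpowr).eventually_ge_atTop 2
  have hj1 := hpow.eventually h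
  have hj2 := ((tendsto_add_atTop_iff_nat 1).2 hpow).eventually h
  have hmain : ∀ᶠ j : ℕ in atTop, 2 ≤ (S ∩ Ioc (K ^ j) (K ^ (j + 1))).ncard ∧
      ((K ^ j : ℕ) : ℝ) ^ γ ≤ ((S ∩ Ioc (K ^ j) (K ^ (j + 1))).ncard : ℝ) := by
    filter_upwards [hlog, hge2, hj1, hj2, eventually_ge_atTop 1] with j hl h2 ha hb hjge
    have hcard : ((S ∩ Icc 1 (K ^ (j + 1))).ncard : ℝ) ≤
        ((S ∩ Icc 1 (K ^ j)).ncard : ℝ) + ((S ∩ Ioc (K ^ j) (K ^ (j + 1))).ncard : ℝ) := by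
      have hsub : S ∩ Icc 1 (K ^ (j + 1)) ⊆
          (S ∩ Icc 1 (K ^ j)) ∪ (S ∩ Ioc (K ^ j) (K ^ (j + 1))) := by
        rintro x ⟨hx1, hx2⟩
        rcases le_or_gt x (K ^ j) with hx | hx
        · exact Or.inl ⟨hx1, hx2.1, hx⟩
        · exact Or.inr ⟨hx1, hx, hx2.2⟩
      have h3 := (ncard_le_ncard hsub (((finite_Icc _ _).inter_of_right _).union
        ((finite_Ioc _ _).inter_of_right _))).trans (ncard_union_le _ _)
      exact_mod_cast h3
    set Z : ℝ := ((K ^ j : ℕ) : ℝ) with hZ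
    have hZ0 : 0 < Z := by rw [hZ]; push_cast; positivity
    have hlogK : 0 < Real.log K := Real.log_pos (by linarith)
    have hlogZ : Real.log Z = j * Real.log K := by rw [hZ]; push_cast; exact Real.log_pow _ _
    have hj' : (1 : ℝ) ≤ j := by exact_mod_cast hjge
    have hlogZ0 : 0 < Real.log Z := by rw [hlogZ]; positivity
    have hZ1 : ((K ^ (j + 1) : ℕ) : ℝ) = Z * K := by rw [hZ]; push_cast; ring
    have hlogZ1 : Real.log (Z * K) ≤ 2 * Real.log Z := by
      rw [Real.log_mul hZ0.ne' hK0.ne', hlogZ]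
      nlinarith
    have hlogZ1pos : 0 < Real.log (Z * K) := by
      rw [Real.log_mul hZ0.ne' hK0.ne']
      positivity
    have hlow := hb.1
    rw [hZ1] at hlow
    have hupp := ha.2
    have hlow2 : (C₂ + 1) * Z ^ p / (Real.log Z) ^ β ≤
        C₁ * (Z * K) ^ p / (Real.log (Z * K)) ^ β := by
      calc (C₂ + 1) * Z ^ p / (Real.log Z) ^ β
          = (((C₂ + 1) * 2 ^ β / C₁) * C₁) * Z ^ p / (2 * Real.log Z) ^ β := by
            rw [Real.mul_rpow (by norm_num) hlogZ0.le]
            field_simp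
        _ ≤ ((K : ℝ) ^ p * C₁) * Z ^ p / (2 * Real.log Z) ^ β := by gcongr
        _ = C₁ * (Z * K) ^ p / (2 * Real.log Z) ^ β := by
            rw [Real.mul_rpow hZ0.le hK0.le]
            ring
        _ ≤ C₁ * (Z * K) ^ p / (Real.log (Z * K)) ^ β := by gcongr
    have hfin : Z ^ γ ≤ ((S ∩ Ioc (K ^ j) (K ^ (j + 1))).ncard : ℝ) := by
      have h5 : Z ^ γ ≤ Z ^ p / (Real.log Z) ^ β := by
        rw [le_div_iff₀ (by positivity)]
        calc Z ^ γ * (Real.log Z) ^ β ≤ Z ^ γ * Z ^ (p - γ) := by gcongr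
          _ = Z ^ p := by rw [← Real.rpow_add hZ0]; congr 1; ring
      have h6 : (C₂ + 1) * Z ^ p / (Real.log Z) ^ β =
          C₂ * Z ^ p / (Real.log Z) ^ β + Z ^ p / (Real.log Z) ^ β := by ring
      linarith
    exact ⟨by exact_mod_cast h2.trans hfin, hfin⟩
  obtain ⟨L, hL⟩ := eventually_atTop.1 hmain
  exact ⟨K, L + 1, hK, by omega, fun i => hL _ (by omega)⟩

lemma le_dimH_increasing (S : Set ℕ) (α : ℝ) (hα : 1 ≤ α) (hS : HasPolyDensity S α) :
    ENNReal.ofReal (1 / (2 * α)) ≤ dimH {x : ℝ | x ∈ Set.Ioo (0 : ℝ) 1 ∧ Irrational x ∧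
        StrictMono (fun n : ℕ => cfDigit n x) ∧ ∀ n : ℕ, cfDigit n x ∈ S} := by
  have hα0 : 0 < α := by linarith
  refine le_of_forall_lt fun r hr => ?_
  have hrtop : r ≠ ⊤ := ne_top_of_lt hr
  obtain ⟨s, hs1, hs2⟩ := exists_between ((ENNReal.lt_ofReal_iff_toReal_lt hrtop).1 hr)
  have hs0 : 0 < s := lt_of_le_of_lt ENNReal.toReal_nonneg hs1
  have hs3 : 2 * s < 1 / α := by
    have : 1 / (2 * α) = (1 / α) / 2 := by field_simp
    linarith
  obtain ⟨γ, hγ1, hγ2⟩ := exists_between hs3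
  obtain ⟨K, L, hK, hL, hb⟩ := exists_blocks S α hα hS γ (by linarith) hγ2
  refine lt_of_lt_of_le ?_ (lower_of_blocks S K L hK hL γ s hs0 (by linarith) hb)
  exact (ENNReal.lt_ofReal_iff_toReal_lt hrtop).2 hs1

/-- If `S` has polynomial density with exponent `α ≥ 1`, then both the set of irrationals
in `(0,1)` with strictly increasing digits all lying in `S`, and the set of those with
pairwise distinct digits all lying in `S`, have Hausdorff dimension `1/(2α)`. -/
theorem stmt13 (S : Set ℕ) (α : ℝ) (hα : 1 ≤ α) (hS : HasPolyDensity S α) :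
    dimH {x : ℝ | x ∈ Set.Ioo (0 : ℝ) 1 ∧ Irrational x ∧
        StrictMono (fun n : ℕ => cfDigit n x) ∧ ∀ n : ℕ, cfDigit n x ∈ S} =
      ENNReal.ofReal (1 / (2 * α)) ∧
    dimH {x : ℝ | x ∈ Set.Ioo (0 : ℝ) 1 ∧ Irrational x ∧
        (∀ m n : ℕ, m ≠ n → cfDigit m x ≠ cfDigit n x) ∧ ∀ n : ℕ, cfDigit n x ∈ S} =
      ENNReal.ofReal (1 / (2 * α)) := by
  have hsub : {x : ℝ | x ∈ Set.Ioo (0 : ℝ) 1 ∧ Irrational x ∧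
        StrictMono (fun n : ℕ => cfDigit n x) ∧ ∀ n : ℕ, cfDigit n x ∈ S} ⊆
      {x : ℝ | x ∈ Set.Ioo (0 : ℝ) 1 ∧ Irrational x ∧
        (∀ m n : ℕ, m ≠ n → cfDigit m x ≠ cfDigit n x) ∧ ∀ n : ℕ, cfDigit n x ∈ S} := by
    rintro x ⟨h1, h2, h3, h4⟩
    exact ⟨h1, h2, fun m n hmn h => hmn (h3.injective h), h4⟩
  have h1 := dimH_distinct_le S α hα hS
  have h2 := le_dimH_increasing S α hα hS
  have h3 := dimH_mono hsub
  exact ⟨le_antisymm (h3.trans h1) h2, le_antisymm h1 (h2.trans h3)⟩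
end

section
/- Let (X, ℬ, μ) be a probability space, T : X → X an invertible measure-preserving transformation, h₁,...,h_ℓ polynomials with integer coefficients vanishing at 0, and A ∈ ℬ with μ(A) > 0. Assume the polynomial multiple recurrence theorem: liminf_{N→∞} (1/N)Σ_{m=0}^{N−1} μ(T^{−h₁(m)}A ∩ ⋯ ∩ T^{−h_ℓ(m)}A) > 0. Then for any S ⊆ ℕ with positive upper Banach density, there exist k, m ∈ ℕ with k+h₁(m), ..., k+h_ℓ(m) ∈ S. -/
open Filter Set MeasureTheory

/-- The upper Banach density `d_B(S) = limsup_{N→∞} (sup_M #(S ∩ [M, M+N])) / N`. -/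
noncomputable def banachDensity (A : Set ℕ) : ℝ :=
  Filter.limsup
    (fun N : ℕ => (⨆ M : ℕ, ((A ∩ Set.Icc M (M + N)).ncard : ℝ)) / N) Filter.atTop

open Topology in
/-- Furstenberg correspondence: a limit of empirical measures along an ultrafilter. -/
theorem furst_limit (φ : ℕ → (ℤ → Bool)) (M N : ℕ → ℕ) :
    ∃ (μ : ProbabilityMeasure (ℤ → Bool)) (U : Ultrafilter ℕ), (U : Filter ℕ) ≤ atTop ∧
      ∀ E : Set (ℤ → Bool), IsClopen E →
        Tendsto (fun i => (((φ ⁻¹' E) ∩ Set.Icc (M i) (M i + N i)).ncard : ℝ) / ((N i : ℝ) + 1))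
          U (𝓝 (((μ : Measure (ℤ → Bool)) E).toReal)) := by
  classical
  have hφ : Measurable φ := measurable_from_top
  let ν : ℕ → Measure ℕ := fun i => ProbabilityTheory.uniformOn (Set.Icc (M i) (M i + N i))
  have hν : ∀ i, IsProbabilityMeasure (ν i) := fun i =>
    ProbabilityTheory.isProbabilityMeasure_uniformOn (Set.finite_Icc _ _) ⟨M i, by simp⟩
  let μs : ℕ → ProbabilityMeasure (ℤ → Bool) := fun i =>
    ⟨(ν i).map φ, Measure.isProbabilityMeasure_map hφ.aemeasurable⟩
  let U : Ultrafilter ℕ := Ultrafilter.of atTop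
  obtain ⟨μ, -, hμ⟩ := isCompact_univ.ultrafilter_le_nhds (U.map μs) (by simp)
  refine ⟨μ, U, Ultrafilter.of_le _, fun E hE => ?_⟩
  have key := ProbabilityMeasure.tendsto_measure_of_isClopen_of_tendsto
    (μs := μs) (L := (U : Filter ℕ)) hμ hE
  have key2 := (NNReal.tendsto_coe.2 key)
  refine key2.congr fun i => ?_
  have h1 : ((μs i E : NNReal) : ℝ) = ((ν i).map φ E).toReal := rfl
  rw [h1, Measure.map_apply hφ hE.isOpen.measurableSet]
  simp only [ν, ProbabilityTheory.uniformOn]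
  rw [ProbabilityTheory.cond_apply (by measurability), ENNReal.toReal_mul,
    Measure.count_apply_finite _ (Set.finite_Icc _ _),
    Measure.count_apply_finite _ ((Set.finite_Icc _ _).inter_of_left _),
    ← Set.ncard_eq_toFinset_card _ (Set.finite_Icc _ _),
    ← Set.ncard_eq_toFinset_card _ ((Set.finite_Icc _ _).inter_of_left _), Set.inter_comm]
  have : (Set.Icc (M i) (M i + N i)).ncard = N i + 1 := by
    rw [← Finset.coe_Icc, Set.ncard_coe_finset]; simp; omega
  rw [this, ENNReal.toReal_inv, div_eq_inv_mul, ENNReal.toReal_natCast, ENNReal.toReal_natCast]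
  push_cast
  rfl

/-- Counting in a window is almost shift invariant. -/
theorem window_shift (P : Set ℕ) (a b : ℕ) :
    |((((fun n => n + 1) ⁻¹' P) ∩ Set.Icc a b).ncard : ℝ) - ((P ∩ Set.Icc a b).ncard : ℝ)| ≤ 1 := by
  have fin1 : (P ∩ Set.Icc a b).Finite := (Set.finite_Icc _ _).inter_of_right _
  have fin2 : (((fun n => n + 1) ⁻¹' P) ∩ Set.Icc a b).Finite :=
    (Set.finite_Icc _ _).inter_of_right _
  have hinj : Function.Injective (fun n : ℕ => n + 1) := fun x y h => by simpa using h
  have e := Set.ncard_image_of_injective (((fun n => n + 1) ⁻¹' P) ∩ Set.Icc a b) hinj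
  have h1 : (((fun n => n + 1) ⁻¹' P) ∩ Set.Icc a b).ncard ≤ (P ∩ Set.Icc a b).ncard + 1 := by
    rw [← e]
    refine le_trans (Set.ncard_le_ncard ?_ (fin1.insert (b + 1))) (Set.ncard_insert_le _ _)
    rintro _ ⟨n, ⟨hn, hn1, hn2⟩, rfl⟩
    by_cases h : n = b
    · left; simp [h]
    · right; exact ⟨hn, by simp only [Set.mem_Icc]; omega⟩
  have h2 : (P ∩ Set.Icc a b).ncard ≤ (((fun n => n + 1) ⁻¹' P) ∩ Set.Icc a b).ncard + 1 := by
    rw [← e]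
    refine le_trans (Set.ncard_le_ncard ?_ ((fin2.image _).insert a)) (Set.ncard_insert_le _ _)
    rintro n ⟨hn, hn1, hn2⟩
    by_cases h : n = a
    · left; exact h
    · right
      have h' : n - 1 + 1 = n := by omega
      exact ⟨n - 1, ⟨by simpa [h'] using hn, by simp only [Set.mem_Icc]; omega⟩, h'⟩
  have h1' : ((((fun n => n + 1) ⁻¹' P) ∩ Set.Icc a b).ncard : ℝ) ≤ (P ∩ Set.Icc a b).ncard + 1 := by
    exact_mod_cast h1
  have h2' : ((P ∩ Set.Icc a b).ncard : ℝ) ≤ (((fun n => n + 1) ⁻¹' P) ∩ Set.Icc a b).ncard + 1 := by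
    exact_mod_cast h2
  rw [abs_le]; constructor <;> linarith

/-- The shift on `{0,1}^ℤ`. -/
def zShift : Equiv.Perm (ℤ → Bool) where
  toFun x := fun n => x (n + 1)
  invFun x := fun n => x (n - 1)
  left_inv x := by funext n; simp
  right_inv x := by funext n; simp

theorem zShift_zpow (k : ℤ) (x : ℤ → Bool) (n : ℤ) : (zShift ^ k) x n = x (n + k) := by
  induction k generalizing n x with
  | zero => simp
  | succ i ih =>
    rw [zpow_add_one, Equiv.Perm.mul_apply, ih]
    change x (n + i + 1) = _
    congr 1; ring
  | pred i ih =>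
    rw [zpow_sub_one, Equiv.Perm.mul_apply, ih]
    change x (n + -i - 1) = _
    congr 1; ring

theorem zShift_continuous : Continuous zShift :=
  continuous_pi fun n => continuous_apply (n + 1)

theorem zShift_symm_continuous : Continuous zShift.symm :=
  continuous_pi fun n => continuous_apply (n - 1)

theorem generate_clopen :
    (inferInstance : MeasurableSpace (ℤ → Bool)) =
      MeasurableSpace.generateFrom {E : Set (ℤ → Bool) | IsClopen E} := by
  apply le_antisymm
  · refine iSup_le fun i => ?_
    rintro _ ⟨s, -, rfl⟩
    exact MeasurableSpace.measurableSet_generateFrom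
      ((isClopen_discrete s).preimage (continuous_apply i))
  · exact MeasurableSpace.generateFrom_le fun E hE => (IsClopen.isOpen hE).measurableSet

theorem window_of_density (S : Set ℕ) (hS : 0 < banachDensity S) :
    ∃ δ : ℝ, 0 < δ ∧ ∀ i : ℕ, ∃ N M : ℕ, i ≤ N ∧
      δ ≤ ((S ∩ Set.Icc M (M + N)).ncard : ℝ) / ((N : ℝ) + 1) := by
  obtain ⟨d, hd0, hd⟩ := exists_between hS
  have hf := frequently_lt_of_lt_limsup
    (isCoboundedUnder_le_of_le (x := 0) _ fun N => by
      apply div_nonneg (Real.iSup_nonneg fun _ => by positivity); positivity) hd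
  refine ⟨d / 2, by positivity, fun i => ?_⟩
  obtain ⟨N, hN, hlt⟩ := (frequently_atTop.1 hf) (i + 1)
  have hNpos : (1 : ℝ) ≤ N := by exact_mod_cast (by omega : 1 ≤ N)
  rw [lt_div_iff₀ (by linarith)] at hlt
  obtain ⟨M, hM⟩ := exists_lt_of_lt_ciSup hlt
  refine ⟨N, M, by omega, ?_⟩
  rw [le_div_iff₀ (by linarith)]
  nlinarith

/-- Assuming the polynomial multiple recurrence theorem (Bergelson–Leibman) for the given
polynomials `h₁, …, h_ℓ ∈ ℤ₀[X]`: for every probability space `(X, μ)`, every invertible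
measure-preserving transformation `T`, and every `A` with `μ(A) > 0`,
`liminf_N (1/N) ∑_{m<N} μ(T^{-h₁(m)}A ∩ ⋯ ∩ T^{-h_ℓ(m)}A) > 0`; then every `S ⊆ ℕ` with
positive upper Banach density contains a pattern `k + h₁(m), …, k + h_ℓ(m)`. -/
theorem stmt15 (ℓ : ℕ) (h : Fin ℓ → Polynomial ℤ)
    (hzero : ∀ j, (h j).eval 0 = 0)
    (hrec : ∀ (X : Type) (_ : MeasurableSpace X) (μ : Measure X)
      (_ : IsProbabilityMeasure μ) (T : Equiv.Perm X),
      Measurable T → Measurable T.symm → MeasurePreserving T μ μ →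
      ∀ A : Set X, MeasurableSet A → 0 < μ A →
        0 < Filter.liminf
          (fun N : ℕ => (1 / (N : ℝ)) * ∑ m ∈ Finset.range N,
            (μ (⋂ j : Fin ℓ, (fun x => (T ^ ((h j).eval (m : ℤ))) x) ⁻¹' A)).toReal)
          Filter.atTop) :
    ∀ S : Set ℕ, 0 < banachDensity S →
      ∃ k m : ℕ, 0 < k ∧ 0 < m ∧
        ∀ j : Fin ℓ, ∃ s ∈ S, (s : ℤ) = (k : ℤ) + (h j).eval (m : ℤ) := by
  classical
  intro S hS
  obtain ⟨δ, hδ, hw⟩ := window_of_density S hS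
  choose N M hN hd using hw
  let φ : ℕ → (ℤ → Bool) := fun n z => decide (∃ s ∈ S, (s : ℤ) = (n : ℤ) + z)
  obtain ⟨μ, U, hU, hlim⟩ := furst_limit φ M N
  have hinv : Tendsto (fun i => (1 : ℝ) / ((N i : ℝ) + 1)) U (nhds 0) := by
    have : Tendsto N atTop atTop := tendsto_atTop_mono hN tendsto_id
    exact (tendsto_one_div_add_atTop_nhds_zero_nat.comp this).mono_left hU
  have hT : Measurable zShift := zShift_continuous.measurable
  have hT' : Measurable zShift.symm := zShift_symm_continuous.measurable
  have hmp : MeasurePreserving zShift (μ : Measure (ℤ → Bool)) μ := by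
    refine ⟨hT, ?_⟩
    have : IsProbabilityMeasure ((μ : Measure (ℤ → Bool)).map zShift) :=
      Measure.isProbabilityMeasure_map hT.aemeasurable
    refine ext_of_generate_finite _ generate_clopen ?_ ?_ (by simp)
    · intro s hs t ht _
      exact IsClopen.inter hs ht
    · intro E hE
      have hE : IsClopen E := hE
      rw [Measure.map_apply hT hE.isOpen.measurableSet]
      have l1 := hlim _ (hE.preimage zShift_continuous)
      have l2 := hlim _ hE
      have l3 := l1.sub l2
      have l0 := squeeze_zero_norm (f := fun i =>
        (((φ ⁻¹' (zShift ⁻¹' E)) ∩ Set.Icc (M i) (M i + N i)).ncard : ℝ) / ((N i : ℝ) + 1) -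
        (((φ ⁻¹' E) ∩ Set.Icc (M i) (M i + N i)).ncard : ℝ) / ((N i : ℝ) + 1))
        (fun i => by
          have hs : φ ⁻¹' (zShift ⁻¹' E) = (fun n => n + 1) ⁻¹' (φ ⁻¹' E) := by
            ext n
            have : zShift (φ n) = φ (n + 1) := by
              funext z
              change φ n (z + 1) = φ (n + 1) z
              simp only [φ]
              congr 1
              push_cast
              simp only [add_assoc, add_comm z 1]
            simp [this]
          rw [hs, ← sub_div, Real.norm_eq_abs, abs_div,
            abs_of_pos (by positivity : (0 : ℝ) < (N i : ℝ) + 1)]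
          exact div_le_div_of_nonneg_right (window_shift _ _ _) (by positivity)) hinv
      have := tendsto_nhds_unique l3 l0
      exact (ENNReal.toReal_eq_toReal_iff' (measure_ne_top _ _) (measure_ne_top _ _)).1
        (sub_eq_zero.1 this)
  let A : Set (ℤ → Bool) := (fun x => x 0) ⁻¹' {true}
  have hA : IsClopen A := (isClopen_discrete _).preimage (continuous_apply 0)
  have hApos : 0 < (μ : Measure (ℤ → Bool)) A := by
    have hge : δ ≤ ((μ : Measure (ℤ → Bool)) A).toReal := by
      refine ge_of_tendsto' (hlim A hA) fun i => ?_
      have : φ ⁻¹' A = S := by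
        ext n; simp [A, φ]
      rw [this]; exact hd i
    by_contra hc
    have : (μ : Measure (ℤ → Bool)) A = 0 := by simpa using hc
    rw [this] at hge
    simp at hge; linarith
  have hpos := hrec (ℤ → Bool) inferInstance μ inferInstance zShift hT hT' hmp A
    hA.isOpen.measurableSet hApos
  set c : ℕ → ℝ := fun m => ((μ : Measure (ℤ → Bool))
    (⋂ j : Fin ℓ, (fun x => (zShift ^ ((h j).eval (m : ℤ))) x) ⁻¹' A)).toReal with hc
  have hm : ∃ m : ℕ, 0 < m ∧ c m ≠ 0 := by
    by_contra! hcon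
    have : Tendsto (fun N : ℕ => (1 / (N : ℝ)) * ∑ m ∈ Finset.range N, c m) atTop (nhds 0) := by
      have h0 : Tendsto (fun N : ℕ => (1 / (N : ℝ)) * c 0) atTop (nhds 0) := by
        simpa using (tendsto_one_div_atTop_nhds_zero_nat (𝕜 := ℝ)).mul_const (c 0)
      refine h0.congr' ?_
      filter_upwards [eventually_ge_atTop 1] with n hn
      rw [Finset.sum_eq_single_of_mem 0 (by simp; omega)
        (fun m _ hm => hcon m (Nat.pos_of_ne_zero hm))]
    rw [this.liminf_eq] at hpos
    exact lt_irrefl _ hpos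
  obtain ⟨m, hm0, hcm⟩ := hm
  set E : Set (ℤ → Bool) := ⋂ j : Fin ℓ, (fun x => (zShift ^ ((h j).eval (m : ℤ))) x) ⁻¹' A with hE
  have hEc : IsClopen E := by
    refine isClopen_iInter_of_finite fun j => hA.preimage ?_
    refine continuous_pi fun n => ?_
    simp only [zShift_zpow]
    exact continuous_apply _
  have hcpos : 0 < ((μ : Measure (ℤ → Bool)) E).toReal :=
    lt_of_le_of_ne ENNReal.toReal_nonneg (Ne.symm hcm)
  have l := (hlim E hEc).sub hinv
  rw [sub_zero] at l
  obtain ⟨i, hi⟩ := (l.eventually_const_lt hcpos).exists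
  rw [← sub_div] at hi
  have hi2 := (div_pos_iff_of_pos_right (by positivity)).1 hi
  have hcard : 1 < ((φ ⁻¹' E) ∩ Set.Icc (M i) (M i + N i)).ncard := by
    have : (1 : ℝ) < ((φ ⁻¹' E) ∩ Set.Icc (M i) (M i + N i)).ncard := by linarith
    exact_mod_cast this
  obtain ⟨k, hk, hk0⟩ := Set.exists_ne_of_one_lt_ncard hcard 0
  refine ⟨k, m, Nat.pos_of_ne_zero hk0, hm0, fun j => ?_⟩
  have h1 := Set.mem_iInter.1 hk.1 j
  have h2 : (zShift ^ ((h j).eval (m : ℤ))) (φ k) 0 = true := h1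
  rw [zShift_zpow, zero_add] at h2
  simpa [φ] using h2
end
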